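/- arXiv:1012.2856 — 2 statements merged into one kernel-verified Lean document; each statement's English description precedes it below -/
import Mathlib

section
/- Let D and C be the N×N matrices with rows indexed by θ ∈ θ_p and columns by θ' ∈ θ_a given by D_{θ,θ'} = e^{−i(l−1/2)(θ−θ')}/(2iN·sin((θ'−θ)/2)) · (√(b_{θ'})/√(b_θ) + √(b_θ)/√(b_{θ'})) and C_{θ,θ'} = e^{−i(l−1/2)(θ+θ')}/(2iN·sin((θ+θ')/2)) · (√(b_θ)√(b_{θ'}) − 1/(√(b_θ)√(b_{θ'}))), and let A and B be the entrywise complex conjugates of D and C respectively. Then A·Bᵀ + B·Aᵀ = 0, C·Dᵀ + D·Cᵀ = 0, and A·Dᵀ + B·Cᵀ = 1 (the N×N identity matrix). -/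
open Finset Matrix

noncomputable section

/-- Antiperiodic momenta: θ_a = {(2j−1)π/N : j = 1,…,N}. -/
def thetaA (N : ℕ) (j : Fin N) : ℝ := (2 * (j : ℝ) + 1) * Real.pi / N

/-- Periodic momenta: θ_p = {2(j−1)π/N : j = 1,…,N}. -/
def thetaP (N : ℕ) (j : Fin N) : ℝ := (2 * (j : ℝ)) * Real.pi / N

/-- b_θ, the principal square root of
`(1−αe^{iθ})(1−βe^{−iθ}) / ((1−βe^{iθ})(1−αe^{−iθ}))`. -/
def bfun (α β θ : ℝ) : ℂ :=
  ((((1 : ℂ) - (α : ℂ) * Complex.exp (Complex.I * θ)) *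
      ((1 : ℂ) - (β : ℂ) * Complex.exp (-Complex.I * θ))) /
    (((1 : ℂ) - (β : ℂ) * Complex.exp (Complex.I * θ)) *
      ((1 : ℂ) - (α : ℂ) * Complex.exp (-Complex.I * θ)))) ^ ((2 : ℂ)⁻¹)

/-- √(b_θ), principal square root. -/
def sqb (α β θ : ℝ) : ℂ := bfun α β θ ^ ((2 : ℂ)⁻¹)

/-- The matrix D, rows indexed by θ ∈ θ_p, columns by θ' ∈ θ_a. -/
def Dmat (N : ℕ) (l : ℤ) (α β : ℝ) : Matrix (Fin N) (Fin N) ℂ :=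
  Matrix.of fun j k =>
    Complex.exp (-Complex.I * ((l : ℂ) - 2⁻¹) * ((thetaP N j : ℝ) - (thetaA N k : ℝ))) /
        (2 * Complex.I * N * Complex.sin ((((thetaA N k : ℝ) : ℂ) - (thetaP N j : ℝ)) / 2)) *
      (sqb α β (thetaA N k) / sqb α β (thetaP N j) +
        sqb α β (thetaP N j) / sqb α β (thetaA N k))

/-- The matrix C, rows indexed by θ ∈ θ_p, columns by θ' ∈ θ_a. -/
def Cmat (N : ℕ) (l : ℤ) (α β : ℝ) : Matrix (Fin N) (Fin N) ℂ :=
  Matrix.of fun j k =>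
    Complex.exp (-Complex.I * ((l : ℂ) - 2⁻¹) * ((thetaP N j : ℝ) + (thetaA N k : ℝ))) /
        (2 * Complex.I * N * Complex.sin ((((thetaP N j : ℝ) : ℂ) + (thetaA N k : ℝ)) / 2)) *
      (sqb α β (thetaP N j) * sqb α β (thetaA N k) -
        1 / (sqb α β (thetaP N j) * sqb α β (thetaA N k)))

/-- ν_θ = ln [∏_{θ'∈θ_a} sinh((γ_θ+γ_{θ'})/2) / ∏_{θ'∈θ_p} sinh((γ_θ+γ_{θ'})/2)]. -/
def nufun (N : ℕ) (γ : ℝ → ℝ) (θ : ℝ) : ℝ :=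
  Real.log ((∏ j : Fin N, Real.sinh ((γ θ + γ (thetaA N j)) / 2)) /
    (∏ j : Fin N, Real.sinh ((γ θ + γ (thetaP N j)) / 2)))

/-- The quotient of a number with positive real part by its conjugate avoids the branch cut. -/
theorem arg_div_conj_ne_pi {z : ℂ} (hz : 0 < z.re) :
    Complex.arg (z / (starRingEnd ℂ) z) ≠ Real.pi := by
  intro h
  rw [Complex.arg_eq_pi_iff] at h
  have hz0 : (starRingEnd ℂ) z ≠ 0 := by
    intro h0
    have := congrArg Complex.re h0
    simp at this
    linarith
  have h1 := congrArg Complex.re (div_mul_cancel₀ z hz0)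
  rw [Complex.mul_re, h.2, Complex.conj_re] at h1
  nlinarith [mul_pos_of_neg_of_neg h.1 (neg_neg_of_pos hz)]

theorem arg_cpow_half_ne_pi (w : ℂ) : Complex.arg (w ^ ((2 : ℂ)⁻¹)) ≠ Real.pi := by
  intro h
  rw [Complex.arg_eq_pi_iff] at h
  rcases eq_or_ne w 0 with rfl | hw
  · simp at h
  · rw [Complex.cpow_def_of_ne_zero hw, Complex.exp_re] at h
    have him : (Complex.log w * (2 : ℂ)⁻¹).im = w.arg / 2 := by
      have h2 : ((2 : ℂ)⁻¹) = ((2⁻¹ : ℝ) : ℂ) := by norm_num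
      rw [h2, Complex.im_mul_ofReal, Complex.log_im]
      ring
    rw [him] at h
    have hc : 0 ≤ Real.cos (w.arg / 2) := Real.cos_nonneg_of_mem_Icc
      ⟨by linarith [Complex.neg_pi_lt_arg w], by linarith [Complex.arg_le_pi w]⟩
    exact absurd h.1 (not_lt.2 (mul_nonneg (Real.exp_pos _).le hc))

theorem conj_exp_I_mul (θ : ℝ) :
    (starRingEnd ℂ) (Complex.exp (Complex.I * θ)) = Complex.exp (-Complex.I * θ) := by
  rw [← Complex.exp_conj]
  simp

theorem conj_exp_neg_I_mul (θ : ℝ) :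
    (starRingEnd ℂ) (Complex.exp (-Complex.I * θ)) = Complex.exp (Complex.I * θ) := by
  rw [← Complex.exp_conj]
  simp

/-- The radicand of `bfun`. -/
def bfunSq (α β θ : ℝ) : ℂ :=
  ((((1 : ℂ) - (α : ℂ) * Complex.exp (Complex.I * θ)) *
      ((1 : ℂ) - (β : ℂ) * Complex.exp (-Complex.I * θ))) /
    (((1 : ℂ) - (β : ℂ) * Complex.exp (Complex.I * θ)) *
      ((1 : ℂ) - (α : ℂ) * Complex.exp (-Complex.I * θ))))

theorem bfun_eq (α β θ : ℝ) : bfun α β θ = bfunSq α β θ ^ ((2 : ℂ)⁻¹) := rfl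

theorem bfunSq_eq_div_conj (α β θ : ℝ) :
    bfunSq α β θ = (((1 : ℂ) - (α : ℂ) * Complex.exp (Complex.I * θ)) *
      ((1 : ℂ) - (β : ℂ) * Complex.exp (-Complex.I * θ))) / (starRingEnd ℂ)
      (((1 : ℂ) - (α : ℂ) * Complex.exp (Complex.I * θ)) *
      ((1 : ℂ) - (β : ℂ) * Complex.exp (-Complex.I * θ))) := by
  simp only [bfunSq, map_mul, map_sub, map_one, Complex.conj_ofReal, conj_exp_I_mul,
    conj_exp_neg_I_mul]
  congr 1
  ring

theorem re_bfunSq_num_pos {α β : ℝ} (hα0 : 0 ≤ α) (hα1 : α < 1) (hβ0 : 0 ≤ β) (hβ1 : β < 1)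
    (θ : ℝ) : 0 < (((1 : ℂ) - (α : ℂ) * Complex.exp (Complex.I * θ)) *
      ((1 : ℂ) - (β : ℂ) * Complex.exp (-Complex.I * θ))).re := by
  have h1 : Complex.exp (Complex.I * θ) = ⟨Real.cos θ, Real.sin θ⟩ := by
    apply Complex.ext <;> simp [Complex.exp_re, Complex.exp_im]
  have h2 : Complex.exp (-Complex.I * θ) = ⟨Real.cos θ, -Real.sin θ⟩ := by
    apply Complex.ext <;> simp [Complex.exp_re, Complex.exp_im]
  rw [h1, h2]
  simp only [Complex.mul_re, Complex.sub_re, Complex.sub_im, Complex.one_re, Complex.one_im,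
    Complex.mul_im, Complex.ofReal_re, Complex.ofReal_im, zero_mul, sub_zero, add_zero]
  have hs := Real.sin_sq_add_cos_sq θ
  have e : (1 - α * Real.cos θ) * (1 - β * Real.cos θ) -
      (0 - α * Real.sin θ) * (0 - β * -Real.sin θ) =
      (1 - α) * (1 - β) + (α + β) * (1 - Real.cos θ) := by
    linear_combination α * β * hs
  rw [e]
  have := mul_pos (sub_pos.2 hα1) (sub_pos.2 hβ1)
  have := mul_nonneg (add_nonneg hα0 hβ0) (sub_nonneg.2 (Real.cos_le_one θ))
  linarith

theorem bfunSq_ne_zero {α β : ℝ} (hα0 : 0 ≤ α) (hα1 : α < 1) (hβ0 : 0 ≤ β) (hβ1 : β < 1)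
    (θ : ℝ) : bfunSq α β θ ≠ 0 := by
  have hz := re_bfunSq_num_pos hα0 hα1 hβ0 hβ1 θ
  rw [bfunSq_eq_div_conj]
  set z := (((1 : ℂ) - (α : ℂ) * Complex.exp (Complex.I * θ)) *
      ((1 : ℂ) - (β : ℂ) * Complex.exp (-Complex.I * θ)))
  have h0 : z ≠ 0 := by
    rintro h
    rw [h] at hz
    simp at hz
  exact div_ne_zero h0 ((map_ne_zero _).2 h0)

theorem arg_bfunSq_ne_pi {α β : ℝ} (hα0 : 0 ≤ α) (hα1 : α < 1) (hβ0 : 0 ≤ β) (hβ1 : β < 1)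
    (θ : ℝ) : (bfunSq α β θ).arg ≠ Real.pi := by
  rw [bfunSq_eq_div_conj]
  exact arg_div_conj_ne_pi (re_bfunSq_num_pos hα0 hα1 hβ0 hβ1 θ)

theorem sqb_ne_zero {α β : ℝ} (hα0 : 0 ≤ α) (hα1 : α < 1) (hβ0 : 0 ≤ β) (hβ1 : β < 1)
    (θ : ℝ) : sqb α β θ ≠ 0 := by
  have h := bfunSq_ne_zero hα0 hα1 hβ0 hβ1 θ
  simp [sqb, bfun_eq, Complex.cpow_eq_zero_iff, h]

theorem sqb_eq_inv_of_bfunSq {α β : ℝ} (hα0 : 0 ≤ α) (hα1 : α < 1) (hβ0 : 0 ≤ β) (hβ1 : β < 1)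
    {θ φ : ℝ} (h : bfunSq α β φ = (bfunSq α β θ)⁻¹) : sqb α β φ = (sqb α β θ)⁻¹ := by
  rw [sqb, sqb, bfun_eq, bfun_eq, h, Complex.inv_cpow _ _ (arg_bfunSq_ne_pi hα0 hα1 hβ0 hβ1 θ),
    Complex.inv_cpow _ _ (arg_cpow_half_ne_pi _)]

theorem sqb_eq_inv {α β : ℝ} (hα0 : 0 ≤ α) (hα1 : α < 1) (hβ0 : 0 ≤ β) (hβ1 : β < 1)
    {θ φ : ℝ} (h : Complex.exp (Complex.I * φ) = Complex.exp (-Complex.I * θ)) :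
    sqb α β φ = (sqb α β θ)⁻¹ := by
  have h' : Complex.exp (-Complex.I * φ) = Complex.exp (Complex.I * θ) := by
    rw [← conj_exp_I_mul, h, conj_exp_neg_I_mul]
  apply sqb_eq_inv_of_bfunSq hα0 hα1 hβ0 hβ1
  rw [bfunSq, bfunSq, h, h', inv_div]
  congr 1 <;> ring

theorem conj_sqb {α β : ℝ} (hα0 : 0 ≤ α) (hα1 : α < 1) (hβ0 : 0 ≤ β) (hβ1 : β < 1)
    (θ : ℝ) : (starRingEnd ℂ) (sqb α β θ) = (sqb α β θ)⁻¹ := by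
  have hw : (starRingEnd ℂ) (bfunSq α β θ) = (bfunSq α β θ)⁻¹ := by
    rw [bfunSq_eq_div_conj, map_div₀, Complex.conj_conj, inv_div]
  have h2 : (starRingEnd ℂ) ((2 : ℂ)⁻¹) = (2 : ℂ)⁻¹ := by
    rw [map_inv₀, Complex.conj_ofNat]
  have hb : (starRingEnd ℂ) (bfun α β θ) = (bfun α β θ)⁻¹ := by
    have harg := arg_bfunSq_ne_pi hα0 hα1 hβ0 hβ1 θ
    rw [bfun_eq, ← Complex.inv_cpow _ _ harg, ← hw, Complex.conj_cpow _ _ harg, h2]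
  have harg : (bfun α β θ).arg ≠ Real.pi := arg_cpow_half_ne_pi _
  rw [sqb, ← Complex.inv_cpow _ _ harg, ← hb, Complex.conj_cpow _ _ harg, h2]

theorem geom_sum_eq_zero_of_pow_eq_one {r : ℂ} {N : ℕ} (hr : r ^ N = 1) (h1 : r ≠ 1) :
    ∑ k ∈ range N, r ^ k = 0 := by
  rw [geom_sum_eq h1, hr, sub_self, zero_div]

theorem inv_one_sub_of_pow_eq_neg_one {u : ℂ} {N : ℕ} (hu : u ^ N = -1) :
    (1 - u)⁻¹ = 2⁻¹ * ∑ k ∈ range N, u ^ k := by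
  have h := mul_neg_geom_sum u N
  rw [hu] at h
  have h0 : (1 - u) ≠ 0 := by
    intro h0
    rw [h0] at h
    norm_num at h
  field_simp
  rw [h]
  norm_num

theorem exp_thetaA (N : ℕ) (j : Fin N) :
    Complex.exp (Complex.I * thetaA N j) =
      Complex.exp (Complex.I * Real.pi / N) * Complex.exp (2 * Real.pi * Complex.I / N) ^ (j : ℕ) := by
  rw [← Complex.exp_nat_mul, ← Complex.exp_add, thetaA]
  congr 1
  push_cast
  ring

theorem exp_thetaA_pow {N : ℕ} (hN : N ≠ 0) (j : Fin N) :
    Complex.exp (Complex.I * thetaA N j) ^ N = -1 := by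
  have hN' : (N : ℂ) ≠ 0 := by exact_mod_cast hN
  have h : (N : ℂ) * (Complex.I * thetaA N j) =
      Real.pi * Complex.I + (j : ℕ) * (2 * Real.pi * Complex.I) := by
    rw [thetaA]
    push_cast
    field_simp
    ring
  rw [← Complex.exp_nat_mul, h, Complex.exp_add, Complex.exp_nat_mul_two_pi_mul_I,
    Complex.exp_pi_mul_I, mul_one]

theorem exp_thetaP_pow {N : ℕ} (hN : N ≠ 0) (j : Fin N) :
    Complex.exp (Complex.I * thetaP N j) ^ N = 1 := by
  have hN' : (N : ℂ) ≠ 0 := by exact_mod_cast hN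
  have h : (N : ℂ) * (Complex.I * thetaP N j) = (j : ℕ) * (2 * Real.pi * Complex.I) := by
    rw [thetaP]
    push_cast
    field_simp
  rw [← Complex.exp_nat_mul, h, Complex.exp_nat_mul_two_pi_mul_I]

theorem exp_thetaP_injective {N : ℕ} (hN : N ≠ 0) :
    Function.Injective fun j : Fin N => Complex.exp (Complex.I * thetaP N j) := by
  have key : ∀ j : Fin N, Complex.exp (Complex.I * thetaP N j) =
      Complex.exp (2 * Real.pi * Complex.I / N) ^ (j : ℕ) := by
    intro j
    rw [← Complex.exp_nat_mul, thetaP]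
    congr 1
    push_cast
    ring
  intro i j h
  simp only [key] at h
  exact Fin.ext ((Complex.isPrimitiveRoot_exp N hN).pow_inj i.2 j.2 h)

/-- Orthogonality of the characters on the antiperiodic momenta. -/
theorem sum_exp_thetaA_pow {N : ℕ} (hN : N ≠ 0) {k m : ℕ} (hk : k < N) (hm : m < N) :
    ∑ j : Fin N, Complex.exp (Complex.I * thetaA N j) ^ k *
      (Complex.exp (Complex.I * thetaA N j))⁻¹ ^ m = if k = m then (N : ℂ) else 0 := by
  split_ifs with h
  · subst h
    simp [Complex.exp_ne_zero]
  · set η := Complex.exp (Complex.I * Real.pi / N)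
    set ξ := Complex.exp (2 * Real.pi * Complex.I / N) with hξ
    have hprim : IsPrimitiveRoot ξ N := Complex.isPrimitiveRoot_exp N hN
    have hξ0 : ξ ≠ 0 := Complex.exp_ne_zero _
    have hterm : ∀ j : Fin N, Complex.exp (Complex.I * thetaA N j) ^ k *
        (Complex.exp (Complex.I * thetaA N j))⁻¹ ^ m =
        η ^ k * η⁻¹ ^ m * (ξ ^ k * ξ⁻¹ ^ m) ^ (j : ℕ) := by
      intro j
      rw [exp_thetaA, mul_inv, mul_pow, mul_pow, mul_pow, ← inv_pow, ← pow_mul, ← pow_mul,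
        ← pow_mul, ← pow_mul, mul_comm (j : ℕ), mul_comm (j : ℕ)]
      ring
    rw [Finset.sum_congr rfl fun j _ => hterm j, ← Finset.mul_sum,
      Fin.sum_univ_eq_sum_range fun j => (ξ ^ k * ξ⁻¹ ^ m) ^ j,
      geom_sum_eq_zero_of_pow_eq_one, mul_zero]
    · rw [mul_pow, ← pow_mul, ← pow_mul, mul_comm k, mul_comm m, pow_mul, pow_mul, inv_pow,
        hprim.pow_eq_one]
      simp
    · intro h1
      rw [inv_pow, mul_inv_eq_one₀ (pow_ne_zero _ hξ0)] at h1
      exact h (hprim.pow_inj hk hm h1)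

theorem sum_inv_one_sub_mul_inv_one_sub {N : ℕ} (hN : N ≠ 0) {X Y : ℂ} (hX : X ^ N = 1)
    (hY : Y ^ N = 1) :
    ∑ j : Fin N, (1 - Complex.exp (Complex.I * thetaA N j) * X)⁻¹ *
      (1 - (Complex.exp (Complex.I * thetaA N j))⁻¹ * Y)⁻¹ =
      N / 4 * ∑ k ∈ range N, (X * Y) ^ k := by
  have hterm : ∀ j : Fin N, (1 - Complex.exp (Complex.I * thetaA N j) * X)⁻¹ *
      (1 - (Complex.exp (Complex.I * thetaA N j))⁻¹ * Y)⁻¹ =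
      ∑ k ∈ range N, ∑ m ∈ range N, 4⁻¹ * (X ^ k * Y ^ m) *
        (Complex.exp (Complex.I * thetaA N j) ^ k *
          (Complex.exp (Complex.I * thetaA N j))⁻¹ ^ m) := by
    intro j
    rw [inv_one_sub_of_pow_eq_neg_one (N := N), inv_one_sub_of_pow_eq_neg_one (N := N),
      mul_mul_mul_comm, Finset.sum_mul_sum, Finset.mul_sum]
    · refine Finset.sum_congr rfl fun k _ => ?_
      rw [Finset.mul_sum]
      refine Finset.sum_congr rfl fun m _ => ?_
      rw [mul_pow, mul_pow]
      ring
    · rw [mul_pow, inv_pow, exp_thetaA_pow hN, hY]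
      norm_num
    · rw [mul_pow, exp_thetaA_pow hN, hX, mul_one]
  rw [Finset.sum_congr rfl fun j _ => hterm j, Finset.sum_comm, Finset.mul_sum]
  refine Finset.sum_congr rfl fun k hk => ?_
  rw [Finset.sum_comm, Finset.sum_eq_single_of_mem k hk]
  · rw [← Finset.mul_sum, sum_exp_thetaA_pow hN (mem_range.1 hk) (mem_range.1 hk), if_pos rfl,
      mul_pow]
    ring
  · intro m hm hne
    rw [← Finset.mul_sum, sum_exp_thetaA_pow hN (mem_range.1 hk) (mem_range.1 hm),
      if_neg hne.symm, mul_zero]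

theorem one_sub_exp_I_mul (x : ℂ) : 1 - Complex.exp (Complex.I * x) =
    -2 * Complex.I * Complex.exp (Complex.I * x / 2) * Complex.sin (x / 2) := by
  have h1 : Complex.exp (Complex.I * x) = Complex.exp (Complex.I * x / 2) ^ 2 := by
    rw [← Complex.exp_nat_mul]
    congr 1
    push_cast
    ring
  have h2 : Complex.exp (Complex.I * x / 2) =
      Complex.cos (x / 2) + Complex.sin (x / 2) * Complex.I := by
    rw [← Complex.exp_mul_I]
    congr 1
    ring
  rw [h1, h2]
  linear_combination (-1 : ℂ) * Complex.sin_sq_add_cos_sq (x / 2) +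
    Complex.sin (x / 2) ^ 2 * Complex.I_sq

theorem sum_inv_sin_mul_inv_sin {N : ℕ} (hN : N ≠ 0) {x y : ℂ}
    (hx : Complex.exp (Complex.I * x) ^ N = 1) (hy : Complex.exp (Complex.I * y) ^ N = 1) :
    ∑ j : Fin N, (Complex.sin ((thetaA N j - x) / 2))⁻¹ *
      (Complex.sin ((thetaA N j - y) / 2))⁻¹ =
      N * Complex.exp (Complex.I * (y - x) / 2) *
        ∑ k ∈ range N, Complex.exp (Complex.I * (y - x)) ^ k := by
  have hxy : Complex.exp (Complex.I * (y - x)) =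
      (Complex.exp (Complex.I * x))⁻¹ * Complex.exp (Complex.I * y) := by
    rw [← Complex.exp_neg, ← Complex.exp_add]
    congr 1
    ring
  have hterm : ∀ j : Fin N, (Complex.sin ((thetaA N j - x) / 2))⁻¹ *
      (Complex.sin ((thetaA N j - y) / 2))⁻¹ = 4 * Complex.exp (Complex.I * (y - x) / 2) *
      ((1 - Complex.exp (Complex.I * thetaA N j) * (Complex.exp (Complex.I * x))⁻¹)⁻¹ *
      (1 - (Complex.exp (Complex.I * thetaA N j))⁻¹ * Complex.exp (Complex.I * y))⁻¹) := by
    intro j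
    have h1 := one_sub_exp_I_mul (thetaA N j - x)
    have h2 := one_sub_exp_I_mul (-(thetaA N j - y))
    have e1 : Complex.exp (Complex.I * thetaA N j) * (Complex.exp (Complex.I * x))⁻¹ =
        Complex.exp (Complex.I * (thetaA N j - x)) := by
      rw [← Complex.exp_neg, ← Complex.exp_add]
      congr 1
      ring
    have e2 : (Complex.exp (Complex.I * thetaA N j))⁻¹ * Complex.exp (Complex.I * y) =
        Complex.exp (Complex.I * (-(thetaA N j - y))) := by
      rw [← Complex.exp_neg, ← Complex.exp_add]
      congr 1
      ring
    have e3 : Complex.exp (Complex.I * (y - x) / 2) =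
        Complex.exp (Complex.I * (thetaA N j - x) / 2) *
          Complex.exp (Complex.I * (-(thetaA N j - y)) / 2) := by
      rw [← Complex.exp_add]
      congr 1
      ring
    rw [e1, e2, h1, h2, e3, neg_div, Complex.sin_neg, ← mul_inv, ← mul_inv]
    set P := Complex.exp (Complex.I * (thetaA N j - x) / 2) with hP
    set Q := Complex.exp (Complex.I * (-(thetaA N j - y)) / 2) with hQ
    have hP0 : P ≠ 0 := Complex.exp_ne_zero _
    have hQ0 : Q ≠ 0 := Complex.exp_ne_zero _
    set S := Complex.sin ((thetaA N j - x) / 2)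
    set T := Complex.sin ((thetaA N j - y) / 2)
    have : -2 * Complex.I * P * S * (-2 * Complex.I * Q * -T) = 4 * (P * Q) * (S * T) := by
      linear_combination (-4 * P * Q * S * T) * Complex.I_sq
    rw [this, mul_inv (4 * (P * Q)), mul_inv_cancel_left₀]
    exact mul_ne_zero (by norm_num) (mul_ne_zero hP0 hQ0)
  rw [Finset.sum_congr rfl fun j _ => hterm j, ← Finset.mul_sum,
    sum_inv_one_sub_mul_inv_one_sub hN (by rw [inv_pow, hx, inv_one]) hy, hxy]
  ring

theorem sum_inv_sin_mul_inv_sin_eq_zero {N : ℕ} (hN : N ≠ 0) {x y : ℂ}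
    (hx : Complex.exp (Complex.I * x) ^ N = 1) (hy : Complex.exp (Complex.I * y) ^ N = 1)
    (hne : Complex.exp (Complex.I * x) ≠ Complex.exp (Complex.I * y)) :
    ∑ j : Fin N, (Complex.sin ((thetaA N j - x) / 2))⁻¹ *
      (Complex.sin ((thetaA N j - y) / 2))⁻¹ = 0 := by
  have hxy : Complex.exp (Complex.I * (y - x)) =
      Complex.exp (Complex.I * y) / Complex.exp (Complex.I * x) := by
    rw [← Complex.exp_sub, mul_sub]
  rw [sum_inv_sin_mul_inv_sin hN hx hy, geom_sum_eq_zero_of_pow_eq_one, mul_zero]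
  · rw [hxy, div_pow, hx, hy, div_one]
  · rw [hxy, Ne, div_eq_one_iff_eq (Complex.exp_ne_zero _)]
    exact hne.symm

theorem sum_inv_sin_mul_inv_sin_self {N : ℕ} (hN : N ≠ 0) {x : ℂ}
    (hx : Complex.exp (Complex.I * x) ^ N = 1) :
    ∑ j : Fin N, (Complex.sin ((thetaA N j - x) / 2))⁻¹ *
      (Complex.sin ((thetaA N j - x) / 2))⁻¹ = (N : ℂ) ^ 2 := by
  rw [sum_inv_sin_mul_inv_sin hN hx hx]
  simp
  ring

theorem thetaA_rev {N : ℕ} (j : Fin N) : thetaA N j.rev = 2 * Real.pi - thetaA N j := by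
  have hN : (N : ℝ) ≠ 0 := by exact_mod_cast (Fin.pos j).ne'
  have h : ((j.rev : ℕ) : ℝ) = N - (j + 1) := by
    rw [Fin.val_rev, Nat.cast_sub j.2]
    push_cast
    ring
  rw [thetaA, thetaA, h]
  field_simp
  ring

theorem sqb_thetaA_rev {α β : ℝ} (hα0 : 0 ≤ α) (hα1 : α < 1) (hβ0 : 0 ≤ β) (hβ1 : β < 1)
    {N : ℕ} (j : Fin N) : sqb α β (thetaA N j.rev) = (sqb α β (thetaA N j))⁻¹ := by
  apply sqb_eq_inv hα0 hα1 hβ0 hβ1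
  rw [thetaA_rev]
  have : Complex.I * ((2 * Real.pi - thetaA N j : ℝ) : ℂ) =
      2 * Real.pi * Complex.I + -Complex.I * thetaA N j := by
    push_cast
    ring
  rw [this, Complex.exp_add, Complex.exp_two_pi_mul_I, one_mul]

theorem Cmat_mul_Dmat_add_rev {α β : ℝ} (hα0 : 0 ≤ α) (hα1 : α < 1) (hβ0 : 0 ≤ β) (hβ1 : β < 1)
    (N : ℕ) (l : ℤ) (p q k : Fin N) :
    Cmat N l α β p k * Dmat N l α β q k + Dmat N l α β p k.rev * Cmat N l α β q k.rev =
      -(Complex.exp (-Complex.I * ((l : ℂ) - 2⁻¹) * (thetaP N p + thetaP N q)) / (2 * N ^ 2)) *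
        (sqb α β (thetaP N p) * sqb α β (thetaP N q) -
          1 / (sqb α β (thetaP N p) * sqb α β (thetaP N q))) *
        ((Complex.sin ((thetaA N k - (-(thetaP N p : ℂ))) / 2))⁻¹ *
          (Complex.sin ((thetaA N k - thetaP N q) / 2))⁻¹) := by
  have hN : (N : ℂ) ≠ 0 := by exact_mod_cast (Fin.pos k).ne'
  have hp := sqb_ne_zero hα0 hα1 hβ0 hβ1 (thetaP N p)
  have hq := sqb_ne_zero hα0 hα1 hβ0 hβ1 (thetaP N q)
  have ha := sqb_ne_zero hα0 hα1 hβ0 hβ1 (thetaA N k)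
  simp only [Cmat, Dmat, Matrix.of_apply, sqb_thetaA_rev hα0 hα1 hβ0 hβ1]
  simp only [thetaA_rev]
  push_cast
  have s1 : Complex.sin ((2 * Real.pi - thetaA N k - thetaP N p) / 2) =
      Complex.sin ((thetaA N k - (-(thetaP N p : ℂ))) / 2) := by
    rw [← Complex.sin_pi_sub]
    congr 1
    ring
  have s2 : Complex.sin ((thetaP N q + (2 * Real.pi - thetaA N k)) / 2) =
      Complex.sin ((thetaA N k - thetaP N q) / 2) := by
    rw [← Complex.sin_pi_sub]
    congr 1
    ring
  have s3 : (thetaP N p + thetaA N k : ℂ) / 2 = (thetaA N k - (-(thetaP N p : ℂ))) / 2 := by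
    ring
  rw [s1, s2, s3]
  set c : ℂ := -Complex.I * ((l : ℂ) - 2⁻¹)
  have x1 : Complex.exp (c * (thetaP N p + thetaA N k)) *
      Complex.exp (c * (thetaP N q - thetaA N k)) =
      Complex.exp (c * (thetaP N p + thetaP N q)) := by
    rw [← Complex.exp_add]
    congr 1
    ring
  have x2 : Complex.exp (c * (thetaP N p - (2 * Real.pi - thetaA N k))) *
      Complex.exp (c * (thetaP N q + (2 * Real.pi - thetaA N k))) =
      Complex.exp (c * (thetaP N p + thetaP N q)) := by
    rw [← Complex.exp_add]
    congr 1
    ring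
  simp only [div_eq_mul_inv, mul_inv, inv_inv, one_mul, Complex.inv_I]
  generalize (Complex.sin ((thetaA N k - (-(thetaP N p : ℂ))) * 2⁻¹))⁻¹ = S
  generalize (Complex.sin ((thetaA N k - thetaP N q) * 2⁻¹))⁻¹ = T
  generalize Complex.exp (c * (thetaP N p + thetaA N k)) = E1 at *
  generalize Complex.exp (c * (thetaP N q - thetaA N k)) = E2 at *
  generalize Complex.exp (c * (thetaP N p - (2 * Real.pi - thetaA N k))) = E3 at *
  generalize Complex.exp (c * (thetaP N q + (2 * Real.pi - thetaA N k))) = E4 at *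
  rw [← x1] at x2 ⊢
  generalize sqb α β (thetaP N p) = sp at *
  generalize sqb α β (thetaP N q) = sq at *
  generalize sqb α β (thetaA N k) = sa at *
  field_simp
  simp only [Complex.I_sq]
  linear_combination (-S * T * (1 + sa ^ 2 * sp ^ 2) * (sq ^ 2 - sa ^ 2)) * x2

theorem conj_Dmat_mul_Dmat_add_rev {α β : ℝ} (hα0 : 0 ≤ α) (hα1 : α < 1) (hβ0 : 0 ≤ β)
    (hβ1 : β < 1) (N : ℕ) (l : ℤ) (p q k : Fin N) :
    (starRingEnd ℂ) (Dmat N l α β p k) * Dmat N l α β q k +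
        (starRingEnd ℂ) (Cmat N l α β p k.rev) * Cmat N l α β q k.rev =
      (Complex.exp (Complex.I * ((l : ℂ) - 2⁻¹) * (thetaP N p - thetaP N q)) / (2 * N ^ 2)) *
        (sqb α β (thetaP N p) / sqb α β (thetaP N q) +
          sqb α β (thetaP N q) / sqb α β (thetaP N p)) *
        ((Complex.sin ((thetaA N k - thetaP N p) / 2))⁻¹ *
          (Complex.sin ((thetaA N k - thetaP N q) / 2))⁻¹) := by
  have hN : (N : ℂ) ≠ 0 := by exact_mod_cast (Fin.pos k).ne'
  have hp := sqb_ne_zero hα0 hα1 hβ0 hβ1 (thetaP N p)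
  have hq := sqb_ne_zero hα0 hα1 hβ0 hβ1 (thetaP N q)
  have ha := sqb_ne_zero hα0 hα1 hβ0 hβ1 (thetaA N k)
  simp only [Cmat, Dmat, Matrix.of_apply, sqb_thetaA_rev hα0 hα1 hβ0 hβ1, map_mul,
    map_div₀, map_add, map_sub, map_one, map_neg, map_inv₀, conj_sqb hα0 hα1 hβ0 hβ1,
    ← Complex.exp_conj, ← Complex.sin_conj, Complex.conj_ofReal, Complex.conj_I,
    Complex.conj_ofNat, Complex.conj_natCast, map_intCast, neg_neg]
  simp only [thetaA_rev]
  push_cast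
  have s1 : Complex.sin ((thetaP N p + (2 * Real.pi - thetaA N k)) / 2) =
      Complex.sin ((thetaA N k - thetaP N p) / 2) := by
    rw [← Complex.sin_pi_sub]
    congr 1
    ring
  have s2 : Complex.sin ((thetaP N q + (2 * Real.pi - thetaA N k)) / 2) =
      Complex.sin ((thetaA N k - thetaP N q) / 2) := by
    rw [← Complex.sin_pi_sub]
    congr 1
    ring
  rw [s1, s2]
  set c : ℂ := (l : ℂ) - 2⁻¹
  have x1 : Complex.exp (Complex.I * c * (thetaP N p - thetaA N k)) *
      Complex.exp (-Complex.I * c * (thetaP N q - thetaA N k)) =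
      Complex.exp (Complex.I * c * (thetaP N p - thetaP N q)) := by
    rw [← Complex.exp_add]
    congr 1
    ring
  have x2 : Complex.exp (Complex.I * c * (thetaP N p + (2 * Real.pi - thetaA N k))) *
      Complex.exp (-Complex.I * c * (thetaP N q + (2 * Real.pi - thetaA N k))) =
      Complex.exp (Complex.I * c * (thetaP N p - thetaP N q)) := by
    rw [← Complex.exp_add]
    congr 1
    ring
  simp only [div_eq_mul_inv, mul_inv, inv_inv, one_mul, Complex.inv_I]
  generalize (Complex.sin ((thetaA N k - thetaP N p) * 2⁻¹))⁻¹ = S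
  generalize (Complex.sin ((thetaA N k - thetaP N q) * 2⁻¹))⁻¹ = T
  generalize Complex.exp (Complex.I * c * (thetaP N p - thetaA N k)) = E1 at *
  generalize Complex.exp (-Complex.I * c * (thetaP N q - thetaA N k)) = E2 at *
  generalize Complex.exp (Complex.I * c * (thetaP N p + (2 * Real.pi - thetaA N k))) = E3 at *
  generalize Complex.exp (-Complex.I * c * (thetaP N q + (2 * Real.pi - thetaA N k))) = E4 at *
  rw [← x1] at x2 ⊢
  generalize sqb α β (thetaP N p) = sp at *
  generalize sqb α β (thetaP N q) = sq at *
  generalize sqb α β (thetaA N k) = sa at *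
  field_simp
  linear_combination (S * T * (sp ^ 2 - sa ^ 2) * (sa ^ 2 - sq ^ 2)) * x2

theorem Cmat_mul_transpose_Dmat_add {α β : ℝ} (hα0 : 0 ≤ α) (hα1 : α < 1) (hβ0 : 0 ≤ β)
    (hβ1 : β < 1) {N : ℕ} (hN : N ≠ 0) (l : ℤ) :
    Cmat N l α β * (Dmat N l α β)ᵀ + Dmat N l α β * (Cmat N l α β)ᵀ = 0 := by
  ext p q
  simp only [Matrix.add_apply, Matrix.mul_apply, Matrix.transpose_apply, Matrix.zero_apply]
  rw [← Equiv.sum_comp Fin.revPerm fun k => Dmat N l α β p k * Cmat N l α β q k,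
    ← Finset.sum_add_distrib]
  simp only [Fin.revPerm_apply, Cmat_mul_Dmat_add_rev hα0 hα1 hβ0 hβ1]
  rw [← Finset.mul_sum]
  have hneg : Complex.exp (Complex.I * -(thetaP N p : ℂ)) =
      (Complex.exp (Complex.I * thetaP N p))⁻¹ := by
    rw [← Complex.exp_neg, mul_neg]
  by_cases h : Complex.exp (Complex.I * -(thetaP N p : ℂ)) = Complex.exp (Complex.I * thetaP N q)
  · have hs : sqb α β (thetaP N q) = (sqb α β (thetaP N p))⁻¹ := by
      apply sqb_eq_inv hα0 hα1 hβ0 hβ1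
      rw [← h, neg_mul, mul_neg]
    rw [hs, mul_inv_cancel₀ (sqb_ne_zero hα0 hα1 hβ0 hβ1 _)]
    simp
  · rw [sum_inv_sin_mul_inv_sin_eq_zero hN _ (exp_thetaP_pow hN q) h, mul_zero]
    rw [hneg, inv_pow, exp_thetaP_pow hN, inv_one]

theorem conj_Dmat_mul_transpose_Dmat_add {α β : ℝ} (hα0 : 0 ≤ α) (hα1 : α < 1) (hβ0 : 0 ≤ β)
    (hβ1 : β < 1) {N : ℕ} (hN : N ≠ 0) (l : ℤ) :
    ((Dmat N l α β).map (starRingEnd ℂ)) * (Dmat N l α β)ᵀ +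
        ((Cmat N l α β).map (starRingEnd ℂ)) * (Cmat N l α β)ᵀ = 1 := by
  ext p q
  simp only [Matrix.add_apply, Matrix.mul_apply, Matrix.transpose_apply, Matrix.map_apply]
  rw [← Equiv.sum_comp Fin.revPerm
    fun k => (starRingEnd ℂ) (Cmat N l α β p k) * Cmat N l α β q k, ← Finset.sum_add_distrib]
  simp only [Fin.revPerm_apply, conj_Dmat_mul_Dmat_add_rev hα0 hα1 hβ0 hβ1]
  rw [← Finset.mul_sum]
  rcases eq_or_ne p q with rfl | hpq
  · have hN' : (N : ℂ) ≠ 0 := by exact_mod_cast hN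
    rw [sum_inv_sin_mul_inv_sin_self hN (exp_thetaP_pow hN p),
      div_self (sqb_ne_zero hα0 hα1 hβ0 hβ1 _), sub_self, mul_zero, Complex.exp_zero,
      Matrix.one_apply_eq]
    field_simp
    norm_num
  · rw [sum_inv_sin_mul_inv_sin_eq_zero hN (exp_thetaP_pow hN p) (exp_thetaP_pow hN q)
      fun h => hpq (exp_thetaP_injective hN h), mul_zero, Matrix.one_apply_ne hpq]

theorem induced_rotation_relations
    (N : ℕ) (hN : 1 ≤ N) (l : ℤ) (Kx Ky Kxs : ℝ)
    (hKx : 0 < Kx) (hKy : 0 < Ky)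
    (hKxs_pos : 0 < Kxs) (hKxs : Real.tanh Kxs = Real.exp (-(2 * Kx)))
    (α β : ℝ)
    (hα : α = Real.tanh Kxs * (Real.cosh Ky / Real.sinh Ky))
    (hβ : β = Real.tanh Kxs * Real.tanh Ky)
    (hferro : Kxs < Ky) :
    ((Dmat N l α β).map (starRingEnd ℂ)) * ((Cmat N l α β).map (starRingEnd ℂ))ᵀ +
        ((Cmat N l α β).map (starRingEnd ℂ)) * ((Dmat N l α β).map (starRingEnd ℂ))ᵀ = 0 ∧
      Cmat N l α β * (Dmat N l α β)ᵀ + Dmat N l α β * (Cmat N l α β)ᵀ = 0 ∧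
      ((Dmat N l α β).map (starRingEnd ℂ)) * (Dmat N l α β)ᵀ +
        ((Cmat N l α β).map (starRingEnd ℂ)) * (Cmat N l α β)ᵀ = 1 := by
  have hN0 : N ≠ 0 := by omega
  have hx : 0 < Real.tanh Kxs := Real.tanh_eq_sinh_div_cosh Kxs ▸
    div_pos (Real.sinh_pos_iff.2 hKxs_pos) (Real.cosh_pos _)
  have hy : 0 < Real.tanh Ky := Real.tanh_eq_sinh_div_cosh Ky ▸
    div_pos (Real.sinh_pos_iff.2 hKy) (Real.cosh_pos _)
  have hxy : Real.tanh Kxs < Real.tanh Ky := by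
    rw [Real.tanh_eq_sinh_div_cosh, Real.tanh_eq_sinh_div_cosh,
      div_lt_div_iff₀ (Real.cosh_pos _) (Real.cosh_pos _)]
    have := Real.sinh_pos_iff.2 (sub_pos.2 hferro)
    rw [Real.sinh_sub] at this
    linarith
  have hα' : α = Real.tanh Kxs / Real.tanh Ky := by
    rw [hα, Real.tanh_eq_sinh_div_cosh Ky, div_div_eq_mul_div, mul_div_assoc]
  have hα0 : 0 ≤ α := hα' ▸ (div_pos hx hy).le
  have hα1 : α < 1 := hα' ▸ (div_lt_one hy).2 hxy
  have hβ0 : 0 ≤ β := hβ ▸ (mul_pos hx hy).le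
  have hβ1 : β < 1 := by
    rw [hβ]
    nlinarith [Real.tanh_lt_one Ky]
  have hCD := Cmat_mul_transpose_Dmat_add hα0 hα1 hβ0 hβ1 hN0 l
  refine ⟨?_, hCD, conj_Dmat_mul_transpose_Dmat_add hα0 hα1 hβ0 hβ1 hN0 l⟩
  rw [add_comm] at hCD
  rw [← Matrix.transpose_map, ← Matrix.transpose_map, ← Matrix.map_mul, ← Matrix.map_mul,
    ← Matrix.map_add _ (map_add _), hCD]
  exact Matrix.map_zero _ (map_zero _)
end
end

section
/- (Trigonometric skew Cauchy determinant identity underlying the multiparticle form factors.) Let m, n ≥ 0 with m+n even, and let θ_1,…,θ_m, θ'_1,…,θ'_n ∈ [0,2π) satisfy θ_i ≠ θ'_j for all i, j. Set ρ = √(sinh 2K_y/sinh 2K_x) and t(θ,φ) = ρ·sin((θ−φ)/2)/sinh((γ_θ+γ_φ)/2). Define the skew-symmetric (m+n)×(m+n) matrix R̃ by: R̃_{jk} = t(θ_j, θ_k) for 1 ≤ j,k ≤ m; R̃_{jk} = t(θ'_{j−m}, θ'_{k−m}) for m+1 ≤ j,k ≤ m+n; R̃_{jk} = 1/t(θ_j,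 θ'_{k−m}) for j ≤ m < k; and R̃_{jk} = −1/t(θ_k, θ'_{j−m}) for k ≤ m < j. Then det R̃ = [ ∏_{1≤i<j≤m} t(θ_i,θ_j) · ∏_{1≤i<j≤n} t(θ'_i,θ'_j) · ∏_{1≤i≤m, 1≤j≤n} t(θ_i,θ'_j)^{−1} ]². -/
open Finset Matrix

noncomputable section

/-- A skew-symmetric kernel whose `4 × 4` Pfaffians factor has determinants that factor. -/
theorem det_of_four_point {α R : Type*} [Field R] (s : α → α → R)
    (hskew : ∀ x y, s y x = -s x y) (hdiag : ∀ x, s x x = 0)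
    (hzero : ∀ x y, s x y = 0 → ∀ z, s x z = s y z)
    (hfour : ∀ x y z w, s x y * s z w - s x z * s y w + s x w * s y z =
      s x y * s x z * s x w * s y z * s y w * s z w) :
    ∀ k N : ℕ, N = 2 * k → ∀ p : Fin N → α,
      (Matrix.of fun i j => s (p i) (p j)).det =
        (∏ i, ∏ j, if i < j then s (p i) (p j) else 1) ^ 2 := by
  intro k
  induction k with
  | zero => rintro N rfl p; simp
  | succ k ih =>
    intro N hN p
    obtain ⟨M, rfl⟩ : ∃ M, N = 2 + M := ⟨2 * k, by omega⟩
    set x := p (Fin.castAdd M 0) with hx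
    set y := p (Fin.castAdd M 1) with hy
    set q : Fin M → α := fun i => p (Fin.natAdd 2 i) with hq
    have hprod : (∏ i, ∏ j, if i < j then s (p i) (p j) else 1) =
        s x y * (∏ i, s x (q i) * s y (q i)) *
          ∏ i, ∏ j, if i < j then s (q i) (q j) else 1 := by
      rw [Fin.prod_univ_add]
      simp only [Fin.prod_univ_add (a := 2), Fin.prod_univ_two]
      simp only [Fin.lt_def, Fin.val_castAdd, Fin.val_natAdd, Fin.val_zero, Fin.val_one,
        Nat.add_lt_add_iff_left]
      have h1 : ∀ i : ℕ, ¬ (2 + i < 0) := by omega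
      have h2 : ∀ i : ℕ, ¬ (2 + i < 1) := by omega
      have h3 : ∀ i : ℕ, 0 < 2 + i := by omega
      have h4 : ∀ i : ℕ, 1 < 2 + i := by omega
      simp [h1, h2, h3, h4, ← hx, ← hy, hq, Finset.prod_mul_distrib]
      left
      ring
    rw [hprod]
    by_cases ha : s x y = 0
    · rw [ha]
      have : (Fin.castAdd M (0 : Fin 2)) ≠ Fin.castAdd M 1 := by simp [Fin.ext_iff]
      rw [Matrix.det_zero_of_row_eq this]
      · ring
      · ext j
        exact hzero _ _ ha _
    · let A : Matrix (Fin 2) (Fin 2) R := !![0, s x y; -s x y, 0]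
      let A' : Matrix (Fin 2) (Fin 2) R := !![0, -(s x y)⁻¹; (s x y)⁻¹, 0]
      have hA : A' * A = 1 := by
        ext i j
        fin_cases i <;> fin_cases j <;> simp [A, A', Matrix.mul_apply, ha]
      let _ : Invertible A := invertibleOfLeftInverse A A' hA
      have hinv : ⅟A = A' := invOf_eq_left_inv hA
      let U : Matrix (Fin 2) (Fin M) R := Matrix.of ![fun j => s x (q j), fun j => s y (q j)]
      let V : Matrix (Fin M) (Fin 2) R := Matrix.of fun i => ![s (q i) x, s (q i) y]
      let D : Matrix (Fin M) (Fin M) R := Matrix.of fun i j => s (q i) (q j)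
      have hblock : (Matrix.of fun i j => s (p i) (p j)).submatrix
          (finSumFinEquiv (m := 2) (n := M)) finSumFinEquiv = Matrix.fromBlocks A U V D := by
        ext i j
        rcases i with i | i <;> rcases j with j | j
        · fin_cases i <;> fin_cases j <;> simp [A, hdiag, ← hx, ← hy, hskew x y]
        · fin_cases i <;> simp [U, ← hx, ← hy, hq]
        · fin_cases j <;> simp [V, ← hx, ← hy, hq]
        · simp [D, hq]
      have hschur : D - V * ⅟A * U = Matrix.diagonal (fun i => s x (q i) * s y (q i)) * D *
          Matrix.diagonal (fun i => s x (q i) * s y (q i)) := by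
        rw [hinv]
        ext i j
        simp only [Matrix.sub_apply, Matrix.mul_diagonal, Matrix.diagonal_mul]
        simp only [D, V, U, A', Matrix.mul_apply, Fin.sum_univ_two, Matrix.of_apply]
        simp
        rw [hskew x (q i), hskew y (q i)]
        field_simp
        linear_combination hfour x y (q i) (q j)
      rw [← Matrix.det_submatrix_equiv_self (finSumFinEquiv (m := 2) (n := M)), hblock,
        Matrix.det_fromBlocks₁₁, hschur, Matrix.det_mul, Matrix.det_mul, Matrix.det_diagonal,
        ih M (by omega) q]
      simp only [A, Matrix.det_fin_two_of]
      ring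

theorem sinh_mul_sinh_eq_cosh_sub_cosh (a b : ℝ) :
    2 * (Real.sinh a * Real.sinh b) = Real.cosh (a + b) - Real.cosh (a - b) := by
  rw [Real.cosh_add, Real.cosh_sub]; ring

theorem sin_mul_sin_eq_cos_sub_cos (a b : ℝ) :
    2 * (Real.sin a * Real.sin b) = Real.cos (a - b) - Real.cos (a + b) := by
  rw [Real.cos_add, Real.cos_sub]; ring

/-- Two points of the curve `cosh g = A - B cos x` satisfy a product relation. -/
theorem sinh_mul_sinh_of_curve {A B x y g h : ℝ} (hx : Real.cosh g = A - B * Real.cos x)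
    (hy : Real.cosh h = A - B * Real.cos y) :
    Real.sinh ((g + h) / 2) * Real.sinh ((g - h) / 2) =
      B * (Real.sin ((x + y) / 2) * Real.sin ((x - y) / 2)) := by
  have h1 := sinh_mul_sinh_eq_cosh_sub_cosh ((g + h) / 2) ((g - h) / 2)
  have h2 := sin_mul_sin_eq_cos_sub_cos ((x + y) / 2) ((x - y) / 2)
  ring_nf at h1 h2 hx hy ⊢
  linear_combination h1 / 2 - B * h2 / 2 + hx / 2 - hy / 2

/-- The amplitude attached to two points of the curve. -/
def amp (ρ x g y h : ℝ) : ℝ := ρ * Real.sin ((x - y) / 2) / Real.sinh ((g + h) / 2)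

/-- Four points of the curve satisfy the Pfaffian relation. -/
theorem amp_four_point {A ρ x₁ x₂ x₃ x₄ g₁ g₂ g₃ g₄ : ℝ}
    (h₁ : Real.cosh g₁ = A - ρ ^ 2 * Real.cos x₁) (h₂ : Real.cosh g₂ = A - ρ ^ 2 * Real.cos x₂)
    (h₃ : Real.cosh g₃ = A - ρ ^ 2 * Real.cos x₃) (h₄ : Real.cosh g₄ = A - ρ ^ 2 * Real.cos x₄)
    (n₁₂ : g₁ + g₂ ≠ 0) (n₁₃ : g₁ + g₃ ≠ 0) (n₁₄ : g₁ + g₄ ≠ 0)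
    (n₂₃ : g₂ + g₃ ≠ 0) (n₂₄ : g₂ + g₄ ≠ 0) (n₃₄ : g₃ + g₄ ≠ 0) :
    amp ρ x₁ g₁ x₂ g₂ * amp ρ x₃ g₃ x₄ g₄ - amp ρ x₁ g₁ x₃ g₃ * amp ρ x₂ g₂ x₄ g₄ +
        amp ρ x₁ g₁ x₄ g₄ * amp ρ x₂ g₂ x₃ g₃ =
      amp ρ x₁ g₁ x₂ g₂ * amp ρ x₁ g₁ x₃ g₃ * amp ρ x₁ g₁ x₄ g₄ * amp ρ x₂ g₂ x₃ g₃ *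
        amp ρ x₂ g₂ x₄ g₄ * amp ρ x₃ g₃ x₄ g₄ := by
  have nz : ∀ {a b : ℝ}, a + b ≠ 0 → Real.sinh ((a + b) / 2) ≠ 0 := fun h => by
    rw [Ne, Real.sinh_eq_zero]; exact div_ne_zero h two_ne_zero
  have m₁₂ := nz n₁₂
  have m₁₃ := nz n₁₃
  have m₁₄ := nz n₁₄
  have m₂₃ := nz n₂₃
  have m₂₄ := nz n₂₄
  have m₃₄ := nz n₃₄
  have c₁₂ := sinh_mul_sinh_of_curve h₁ h₂
  have c₁₃ := sinh_mul_sinh_of_curve h₁ h₃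
  have c₂₄ := sinh_mul_sinh_of_curve h₂ h₄
  have c₃₄ := sinh_mul_sinh_of_curve h₃ h₄
  obtain ⟨P, hP⟩ : ∃ P, P = Real.cosh ((g₁ + g₂ + g₃ + g₄) / 2) := ⟨_, rfl⟩
  obtain ⟨a₂, ha₂⟩ : ∃ a, a = Real.cosh ((g₁ + g₂ - g₃ - g₄) / 2) := ⟨_, rfl⟩
  obtain ⟨a₃, ha₃⟩ : ∃ a, a = Real.cosh ((g₁ - g₂ + g₃ - g₄) / 2) := ⟨_, rfl⟩
  obtain ⟨a₄, ha₄⟩ : ∃ a, a = Real.cosh ((g₁ - g₂ - g₃ + g₄) / 2) := ⟨_, rfl⟩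
  obtain ⟨Q, hQ⟩ : ∃ Q, Q = Real.cos ((x₁ + x₂ + x₃ + x₄) / 2) := ⟨_, rfl⟩
  obtain ⟨b₂, hb₂⟩ : ∃ a, a = Real.cos ((x₁ + x₂ - x₃ - x₄) / 2) := ⟨_, rfl⟩
  obtain ⟨b₃, hb₃⟩ : ∃ a, a = Real.cos ((x₁ - x₂ + x₃ - x₄) / 2) := ⟨_, rfl⟩
  obtain ⟨b₄, hb₄⟩ : ∃ a, a = Real.cos ((x₁ - x₂ - x₃ + x₄) / 2) := ⟨_, rfl⟩
  have p₂ : 2 * (Real.sinh ((g₁ + g₂) / 2) * Real.sinh ((g₃ + g₄) / 2)) = P - a₂ := by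
    rw [sinh_mul_sinh_eq_cosh_sub_cosh, hP, ha₂]; ring_nf
  have p₃ : 2 * (Real.sinh ((g₁ + g₃) / 2) * Real.sinh ((g₂ + g₄) / 2)) = P - a₃ := by
    rw [sinh_mul_sinh_eq_cosh_sub_cosh, hP, ha₃]; ring_nf
  have p₄ : 2 * (Real.sinh ((g₁ + g₄) / 2) * Real.sinh ((g₂ + g₃) / 2)) = P - a₄ := by
    rw [sinh_mul_sinh_eq_cosh_sub_cosh, hP, ha₄]; ring_nf
  have r₂ : 2 * (Real.sinh ((g₁ - g₂) / 2) * Real.sinh ((g₃ - g₄) / 2)) = a₃ - a₄ := by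
    rw [sinh_mul_sinh_eq_cosh_sub_cosh, ha₃, ha₄]; ring_nf
  have r₃ : 2 * (Real.sinh ((g₁ - g₃) / 2) * Real.sinh ((g₂ - g₄) / 2)) = a₂ - a₄ := by
    rw [sinh_mul_sinh_eq_cosh_sub_cosh, ha₂, ha₄]; ring_nf
  have u₂ : 2 * (Real.sin ((x₁ + x₂) / 2) * Real.sin ((x₃ + x₄) / 2)) = b₂ - Q := by
    rw [sin_mul_sin_eq_cos_sub_cos, hQ, hb₂]; ring_nf
  have u₃ : 2 * (Real.sin ((x₁ + x₃) / 2) * Real.sin ((x₂ + x₄) / 2)) = b₃ - Q := by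
    rw [sin_mul_sin_eq_cos_sub_cos, hQ, hb₃]; ring_nf
  have v₂ : 2 * (Real.sin ((x₁ - x₂) / 2) * Real.sin ((x₃ - x₄) / 2)) = b₄ - b₃ := by
    rw [sin_mul_sin_eq_cos_sub_cos, hb₃, hb₄]; ring_nf
  have v₃ : 2 * (Real.sin ((x₁ - x₃) / 2) * Real.sin ((x₂ - x₄) / 2)) = b₄ - b₂ := by
    rw [sin_mul_sin_eq_cos_sub_cos, hb₂, hb₄]; ring_nf
  have v₄ : 2 * (Real.sin ((x₁ - x₄) / 2) * Real.sin ((x₂ - x₃) / 2)) = b₃ - b₂ := by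
    rw [sin_mul_sin_eq_cos_sub_cos, hb₂, hb₃]; ring_nf
  have w₂ : (P - a₂) * (a₃ - a₄) = ρ ^ 4 * ((b₂ - Q) * (b₄ - b₃)) := by
    rw [← p₂, ← r₂, ← u₂, ← v₂]
    linear_combination 4 * (Real.sinh ((g₃ + g₄) / 2) * Real.sinh ((g₃ - g₄) / 2)) * c₁₂ +
      4 * (ρ ^ 2 * (Real.sin ((x₁ + x₂) / 2) * Real.sin ((x₁ - x₂) / 2))) * c₃₄
  have w₃ : (P - a₃) * (a₂ - a₄) = ρ ^ 4 * ((b₃ - Q) * (b₄ - b₂)) := by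
    rw [← p₃, ← r₃, ← u₃, ← v₃]
    linear_combination 4 * (Real.sinh ((g₂ + g₄) / 2) * Real.sinh ((g₂ - g₄) / 2)) * c₁₃ +
      4 * (ρ ^ 2 * (Real.sin ((x₁ + x₃) / 2) * Real.sin ((x₁ - x₃) / 2))) * c₂₄
  have key : (b₄ - b₃) * ((P - a₃) * (P - a₄)) - (b₄ - b₂) * ((P - a₂) * (P - a₄)) +
      (b₃ - b₂) * ((P - a₂) * (P - a₃)) =
      ρ ^ 4 * ((b₄ - b₃) * (b₄ - b₂) * (b₃ - b₂)) := by
    linear_combination (b₄ - b₃) * w₃ - (b₄ - b₂) * w₂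
  have z₂ : P - a₂ ≠ 0 := by rw [← p₂]; positivity
  have z₃ : P - a₃ ≠ 0 := by rw [← p₃]; positivity
  have z₄ : P - a₄ ≠ 0 := by rw [← p₄]; positivity
  have e₂ : amp ρ x₁ g₁ x₂ g₂ * amp ρ x₃ g₃ x₄ g₄ = ρ ^ 2 * (b₄ - b₃) / (P - a₂) := by
    rw [← p₂, ← v₂]; unfold amp; field_simp
  have e₃ : amp ρ x₁ g₁ x₃ g₃ * amp ρ x₂ g₂ x₄ g₄ = ρ ^ 2 * (b₄ - b₂) / (P - a₃) := by
    rw [← p₃, ← v₃]; unfold amp; field_simp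
  have e₄ : amp ρ x₁ g₁ x₄ g₄ * amp ρ x₂ g₂ x₃ g₃ = ρ ^ 2 * (b₃ - b₂) / (P - a₄) := by
    rw [← p₄, ← v₄]; unfold amp; field_simp
  calc _ = ρ ^ 2 * (b₄ - b₃) / (P - a₂) - ρ ^ 2 * (b₄ - b₂) / (P - a₃) +
        ρ ^ 2 * (b₃ - b₂) / (P - a₄) := by rw [e₂, e₃, e₄]
    _ = (ρ ^ 2 * (b₄ - b₃) / (P - a₂)) * (ρ ^ 2 * (b₄ - b₂) / (P - a₃)) *
        (ρ ^ 2 * (b₃ - b₂) / (P - a₄)) := by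
      field_simp
      linear_combination ρ ^ 2 * key
    _ = _ := by rw [← e₂, ← e₃, ← e₄]; ring

/-- Reflecting a point of the curve through the origin inverts the amplitude. -/
theorem amp_neg {A ρ x y g h : ℝ} (hx : Real.cosh g = A - ρ ^ 2 * Real.cos x)
    (hy : Real.cosh h = A - ρ ^ 2 * Real.cos y) (hadd : g + h ≠ 0) (hsub : g - h ≠ 0) :
    amp ρ x g y h ≠ 0 ∧ amp ρ x g (-y) (-h) = (amp ρ x g y h)⁻¹ := by
  have c := sinh_mul_sinh_of_curve hx hy
  have m₁ : Real.sinh ((g + h) / 2) ≠ 0 := by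
    rw [Ne, Real.sinh_eq_zero]; exact div_ne_zero hadd two_ne_zero
  have m₂ : Real.sinh ((g - h) / 2) ≠ 0 := by
    rw [Ne, Real.sinh_eq_zero]; exact div_ne_zero hsub two_ne_zero
  have m₃ : ρ ^ 2 * (Real.sin ((x + y) / 2) * Real.sin ((x - y) / 2)) ≠ 0 := by
    rw [← c]; exact mul_ne_zero m₁ m₂
  have hρ : ρ ≠ 0 := fun h => m₃ (by simp [h])
  have hs : Real.sin ((x - y) / 2) ≠ 0 := fun h => m₃ (by simp [h])
  unfold amp
  refine ⟨div_ne_zero (mul_ne_zero hρ hs) m₁, ?_⟩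
  rw [sub_neg_eq_add, ← sub_eq_add_neg]
  field_simp
  linear_combination -c

/-- The cocycle relation, away from points with equal `g`. -/
theorem amp_cocycle_of_ne {A ρ x₁ x₂ x₃ x₄ g₁ g₂ g₃ g₄ : ℝ}
    (h₁ : Real.cosh g₁ = A - ρ ^ 2 * Real.cos x₁) (h₂ : Real.cosh g₂ = A - ρ ^ 2 * Real.cos x₂)
    (h₃ : Real.cosh g₃ = A - ρ ^ 2 * Real.cos x₃) (h₄ : Real.cosh g₄ = A - ρ ^ 2 * Real.cos x₄)
    (p₁ : 0 < g₁) (p₂ : 0 < g₂) (p₃ : 0 < g₃) (p₄ : 0 < g₄)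
    (n₁ : g₁ ≠ g₄) (n₂ : g₂ ≠ g₄) (n₃ : g₃ ≠ g₄) :
    amp ρ x₁ g₁ x₂ g₂ * amp ρ x₁ g₁ x₃ g₃ * amp ρ x₂ g₂ x₃ g₃ -
      amp ρ x₁ g₁ x₂ g₂ * amp ρ x₁ g₁ x₄ g₄ * amp ρ x₂ g₂ x₄ g₄ +
      amp ρ x₁ g₁ x₃ g₃ * amp ρ x₁ g₁ x₄ g₄ * amp ρ x₃ g₃ x₄ g₄ -
      amp ρ x₂ g₂ x₃ g₃ * amp ρ x₂ g₂ x₄ g₄ * amp ρ x₃ g₃ x₄ g₄ = 0 := by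
  have h₄' : Real.cosh (-g₄) = A - ρ ^ 2 * Real.cos (-x₄) := by simpa using h₄
  have key := amp_four_point h₁ h₂ h₃ h₄' (by positivity) (by positivity)
    (by rwa [← sub_eq_add_neg, sub_ne_zero]) (by positivity)
    (by rwa [← sub_eq_add_neg, sub_ne_zero]) (by rwa [← sub_eq_add_neg, sub_ne_zero])
  obtain ⟨z₁, e₁⟩ := amp_neg h₁ h₄ (by positivity) (sub_ne_zero.2 n₁)
  obtain ⟨z₂, e₂⟩ := amp_neg h₂ h₄ (by positivity) (sub_ne_zero.2 n₂)
  obtain ⟨z₃, e₃⟩ := amp_neg h₃ h₄ (by positivity) (sub_ne_zero.2 n₃)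
  rw [e₁, e₂, e₃] at key
  field_simp at key
  linear_combination -key

/-- The cocycle relation on the branch `γ > 0` of the curve. -/
theorem amp_cocycle {A ρ : ℝ} (hρ : ρ ≠ 0) {γ : ℝ → ℝ} (hpos : ∀ x, 0 < γ x)
    (hγ : ∀ x, Real.cosh (γ x) = A - ρ ^ 2 * Real.cos x) (x₁ x₂ x₃ x₄ : ℝ) :
    amp ρ x₁ (γ x₁) x₂ (γ x₂) * amp ρ x₁ (γ x₁) x₃ (γ x₃) * amp ρ x₂ (γ x₂) x₃ (γ x₃) -
      amp ρ x₁ (γ x₁) x₂ (γ x₂) * amp ρ x₁ (γ x₁) x₄ (γ x₄) * amp ρ x₂ (γ x₂) x₄ (γ x₄) +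
      amp ρ x₁ (γ x₁) x₃ (γ x₃) * amp ρ x₁ (γ x₁) x₄ (γ x₄) * amp ρ x₃ (γ x₃) x₄ (γ x₄) -
      amp ρ x₂ (γ x₂) x₃ (γ x₃) * amp ρ x₂ (γ x₂) x₄ (γ x₄) * amp ρ x₃ (γ x₃) x₄ (γ x₄) = 0 := by
  obtain ⟨c, hc, hcn⟩ := (Set.Icc_infinite (show (-1 : ℝ) < 1 by norm_num)).exists_notMem_finset
    {Real.cos x₁, Real.cos x₂, Real.cos x₃, Real.cos x₄}
  obtain ⟨y, rfl⟩ : ∃ y, Real.cos y = c := ⟨_, Real.cos_arccos hc.1 hc.2⟩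
  simp only [Finset.mem_insert, Finset.mem_singleton, not_or] at hcn
  have hne : ∀ x, Real.cos y ≠ Real.cos x → γ x ≠ γ y := fun x hx h => hx <| by
    have h' := hγ x
    rw [h, hγ y] at h'
    exact mul_left_cancel₀ (pow_ne_zero 2 hρ) (by linarith)
  have n₁ := hne _ hcn.1
  have n₂ := hne _ hcn.2.1
  have n₃ := hne _ hcn.2.2.1
  have n₄ := hne _ hcn.2.2.2
  have k₁ := amp_cocycle_of_ne (hγ x₂) (hγ x₃) (hγ x₄) (hγ y) (hpos _) (hpos _) (hpos _) (hpos _)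
    n₂ n₃ n₄
  have k₂ := amp_cocycle_of_ne (hγ x₁) (hγ x₃) (hγ x₄) (hγ y) (hpos _) (hpos _) (hpos _) (hpos _)
    n₁ n₃ n₄
  have k₃ := amp_cocycle_of_ne (hγ x₁) (hγ x₂) (hγ x₄) (hγ y) (hpos _) (hpos _) (hpos _) (hpos _)
    n₁ n₂ n₄
  have k₄ := amp_cocycle_of_ne (hγ x₁) (hγ x₂) (hγ x₃) (hγ y) (hpos _) (hpos _) (hpos _) (hpos _)
    n₁ n₂ n₃
  linear_combination k₄ - k₃ + k₂ - k₁

/-- Dual couplings satisfy `sinh 2L · sinh 2K = 1`. -/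
theorem sinh_two_mul_mul_sinh_two_mul_of_dual {K L : ℝ} (h : Real.tanh L = Real.exp (-(2 * K))) :
    Real.sinh (2 * L) * Real.sinh (2 * K) = 1 := by
  rw [Real.tanh_eq_sinh_div_cosh, div_eq_iff (Real.cosh_pos L).ne'] at h
  have h1 := Real.cosh_sq L
  have h2 : Real.exp (2 * K) * Real.exp (-(2 * K)) = 1 := by rw [← Real.exp_add]; simp
  rw [Real.sinh_two_mul, Real.sinh_eq (2 * K)]
  set e := Real.exp (-(2 * K))
  rw [h] at h1 ⊢
  linear_combination Real.cosh L ^ 2 * h2 + h1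

/-- Trigonometric skew Cauchy determinant identity underlying the
multiparticle Ising form factors. -/
theorem skew_cauchy_det
    (Kx Ky Kxs : ℝ)
    (hKx : 0 < Kx) (hKy : 0 < Ky)
    (hKxs_pos : 0 < Kxs) (hKxs : Real.tanh Kxs = Real.exp (-(2 * Kx)))
    (hferro : Kxs < Ky)
    (γ : ℝ → ℝ) (hγ_nonneg : ∀ θ, 0 ≤ γ θ)
    (hγ : ∀ θ, Real.cosh (γ θ) =
      Real.cosh (2 * Kxs) * Real.cosh (2 * Ky) -
        Real.sinh (2 * Kxs) * Real.sinh (2 * Ky) * Real.cos θ)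
    (m n : ℕ) (hmn : Even (m + n))
    (θ : Fin m → ℝ) (θ' : Fin n → ℝ)
    (hθ : ∀ i, 0 ≤ θ i ∧ θ i < 2 * Real.pi)
    (hθ' : ∀ j, 0 ≤ θ' j ∧ θ' j < 2 * Real.pi)
    (hne : ∀ i j, θ i ≠ θ' j)
    (ρ : ℝ) (hρ : ρ = Real.sqrt (Real.sinh (2 * Ky) / Real.sinh (2 * Kx)))
    (t : ℝ → ℝ → ℝ)
    (ht : ∀ a b, t a b = ρ * Real.sin ((a - b) / 2) / Real.sinh ((γ a + γ b) / 2)) :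
    (Matrix.of fun a b : Fin m ⊕ Fin n =>
        match a, b with
        | Sum.inl j, Sum.inl k => t (θ j) (θ k)
        | Sum.inl j, Sum.inr k => 1 / t (θ j) (θ' k)
        | Sum.inr j, Sum.inl k => -(1 / t (θ k) (θ' j))
        | Sum.inr j, Sum.inr k => t (θ' j) (θ' k)).det =
      ((∏ i : Fin m, ∏ j ∈ univ.filter (fun j => i < j), t (θ i) (θ j)) *
          (∏ i : Fin n, ∏ j ∈ univ.filter (fun j => i < j), t (θ' i) (θ' j)) *
          ∏ i : Fin m, ∏ j : Fin n, (t (θ i) (θ' j))⁻¹) ^ 2 := by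
  have hKK := sinh_two_mul_mul_sinh_two_mul_of_dual hKxs
  have hsKx : 0 < Real.sinh (2 * Kx) := Real.sinh_pos_iff.2 (by positivity)
  have hsKy : 0 < Real.sinh (2 * Ky) := Real.sinh_pos_iff.2 (by positivity)
  have hsKxs : 0 < Real.sinh (2 * Kxs) := Real.sinh_pos_iff.2 (by positivity)
  have hρpos : 0 < ρ := hρ ▸ Real.sqrt_pos.2 (div_pos hsKy hsKx)
  have hρsq : ρ ^ 2 = Real.sinh (2 * Kxs) * Real.sinh (2 * Ky) := by
    rw [hρ, Real.sq_sqrt (div_pos hsKy hsKx).le, div_eq_iff hsKx.ne']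
    linear_combination -Real.sinh (2 * Ky) * hKK
  have hpos : ∀ x, 0 < γ x := fun x => by
    refine (hγ_nonneg x).lt_of_ne' fun h => ?_
    have h1 := hγ x
    rw [h, Real.cosh_zero] at h1
    have h2 : 1 < Real.cosh (2 * Kxs - 2 * Ky) := Real.one_lt_cosh.2 (by linarith)
    rw [Real.cosh_sub] at h2
    nlinarith [Real.cos_le_one x, mul_pos hsKxs hsKy]
  rw [← hρsq] at hγ
  have hcurve : ∀ x, Real.cosh (γ x) = Real.cosh (2 * Kxs) * Real.cosh (2 * Ky) -
      ρ ^ 2 * Real.cos x := hγ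
  have htamp : ∀ a b, t a b = amp ρ a (γ a) b (γ b) := ht
  have hsinh : ∀ a b, Real.sinh ((γ a + γ b) / 2) ≠ 0 := fun a b =>
    (Real.sinh_pos_iff.2 (by linarith [hpos a, hpos b])).ne'
  have hskew : ∀ a b, t b a = -t a b := fun a b => by
    rw [ht, ht, add_comm (γ b), ← neg_sub a b, neg_div, Real.sin_neg]; ring
  have hdiag : ∀ a, t a a = 0 := fun a => by rw [ht]; simp
  have hzero : ∀ a b, 0 ≤ a ∧ a < 2 * Real.pi → 0 ≤ b ∧ b < 2 * Real.pi → t a b = 0 → a = b := by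
    intro a b ha hb h
    rw [ht, div_eq_zero_iff, mul_eq_zero, or_iff_left (hsinh a b), or_iff_right hρpos.ne',
      Real.sin_eq_zero_iff_of_lt_of_lt (by linarith) (by linarith)] at h
    linarith
  have hfour : ∀ a b c d, t a b * t c d - t a c * t b d + t a d * t b c =
      t a b * t a c * t a d * t b c * t b d * t c d := fun a b c d => by
    have hn : ∀ x y, γ x + γ y ≠ 0 := fun x y => (add_pos (hpos x) (hpos y)).ne'
    simp only [htamp]
    exact amp_four_point (hcurve a) (hcurve b) (hcurve c) (hcurve d) (hn _ _) (hn _ _) (hn _ _)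
      (hn _ _) (hn _ _) (hn _ _)
  have hcocycle : ∀ a b c d, t a b * t a c * t b c - t a b * t a d * t b d +
      t a c * t a d * t c d - t b c * t b d * t c d = 0 := fun a b c d => by
    simp only [htamp]
    exact amp_cocycle hρpos.ne' hpos hcurve a b c d
  have hmixed : ∀ i j, t (θ i) (θ' j) ≠ 0 := fun i j h =>
    hne i j (hzero _ _ (hθ i) (hθ' j) h)
  set s : Fin m ⊕ Fin n → Fin m ⊕ Fin n → ℝ := fun a b =>
    match a, b with
    | Sum.inl j, Sum.inl k => t (θ j) (θ k)
    | Sum.inl j, Sum.inr k => 1 / t (θ j) (θ' k)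
    | Sum.inr j, Sum.inl k => -(1 / t (θ k) (θ' j))
    | Sum.inr j, Sum.inr k => t (θ' j) (θ' k) with hs
  obtain ⟨k, hk⟩ := hmn
  have hdet := det_of_four_point s
    (by
      rintro (i | i) (j | j)
      · exact hskew _ _
      · rfl
      · exact (neg_neg _).symm
      · exact hskew _ _)
    (by rintro (i | i) <;> simp [hs, hdiag])
    (by
      rintro (i | i) (j | j) h
      · have h' := hzero _ _ (hθ i) (hθ j) h
        rintro (l | l) <;> simp [hs, h']
      · simp [hs, hmixed] at h
      · simp [hs, hmixed] at h
      · have h' := hzero _ _ (hθ' i) (hθ' j) h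
        rintro (l | l) <;> simp [hs, h'])
    (by
      rintro (a | a) (b | b) (c | c) (d | d) <;> simp only [hs]
      · exact hfour _ _ _ _
      · have h := hcocycle (θ a) (θ b) (θ c) (θ' d)
        field_simp [hmixed]
        linear_combination -h
      · have h := hcocycle (θ a) (θ b) (θ d) (θ' c)
        field_simp [hmixed]
        linear_combination h
      · have h := hfour (θ a) (θ b) (θ' c) (θ' d)
        field_simp [hmixed]
        linear_combination -h
      · have h := hcocycle (θ a) (θ c) (θ d) (θ' b)
        field_simp [hmixed]
        linear_combination -h
      · have h := hfour (θ a) (θ c) (θ' b) (θ' d)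
        field_simp [hmixed]
        linear_combination h
      · have h := hfour (θ a) (θ d) (θ' b) (θ' c)
        field_simp [hmixed]
        linear_combination -h
      · have h := hcocycle (θ' b) (θ' c) (θ' d) (θ a)
        simp only [hskew (θ _) (θ' _)] at h
        field_simp [hmixed]
        linear_combination -h
      · have h := hcocycle (θ b) (θ c) (θ d) (θ' a)
        field_simp [hmixed]
        linear_combination h
      · have h := hfour (θ b) (θ c) (θ' a) (θ' d)
        field_simp [hmixed]
        linear_combination -h
      · have h := hfour (θ b) (θ d) (θ' a) (θ' c)
        field_simp [hmixed]
        linear_combination h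
      · have h := hcocycle (θ' a) (θ' c) (θ' d) (θ b)
        simp only [hskew (θ _) (θ' _)] at h
        field_simp [hmixed]
        linear_combination h
      · have h := hfour (θ c) (θ d) (θ' a) (θ' b)
        field_simp [hmixed]
        linear_combination -h
      · have h := hcocycle (θ' a) (θ' b) (θ' d) (θ c)
        simp only [hskew (θ _) (θ' _)] at h
        field_simp [hmixed]
        linear_combination -h
      · have h := hcocycle (θ' a) (θ' b) (θ' c) (θ d)
        simp only [hskew (θ _) (θ' _)] at h
        field_simp [hmixed]
        linear_combination h
      · exact hfour _ _ _ _)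
    k (m + n) (by omega) finSumFinEquiv.symm
  rw [← Matrix.det_submatrix_equiv_self (finSumFinEquiv (m := m) (n := n)).symm]
  refine hdet.trans ?_
  congr 1
  simp only [Fin.prod_univ_add, Finset.prod_filter]
  have h1 : ∀ (i : Fin m) (j : Fin n), Fin.castAdd n i < Fin.natAdd m j := fun i j => by
    simp only [Fin.lt_def, Fin.val_castAdd, Fin.val_natAdd]; omega
  have h2 : ∀ (i : Fin m) (j : Fin n), ¬ Fin.natAdd m j < Fin.castAdd n i := fun i j =>
    (h1 i j).le.not_gt
  have h3 : ∀ i j : Fin m, Fin.castAdd n i < Fin.castAdd n j ↔ i < j := fun _ _ => Iff.rfl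
  simp [h1, h2, h3, hs, Finset.prod_mul_distrib]
  ring
end
end
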